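/- arXiv:2303.08587 — 2 statements merged into one kernel-verified Lean document; each statement's English description precedes it below -/
import Mathlib

section
/- (Theorem 1 / approximation rate for Barron functions.) Let σ : ℝ → ℝ be twice continuously differentiable such that γ₀(σ) = ∫_ℝ |σ''(x)|(|x|+1) dx < ∞ and such that the limits σ'(+∞) and σ'(−∞) exist, and let C_σ = (γ(σ) + min{|σ'(+∞)|, |σ'(−∞)|} + |σ(0)|)². Let μ be a probability measure on ℝᵈ supported in the closed sup-norm unit ball {x ∈ ℝᵈ : ‖x‖_∞ ≤ 1}, and let ρ be a probability measure on ℝ × ℝᵈ × ℝ with B² := ∫ a²(‖w‖₁+|b|+1)² dρ(a,w,b) < ∞, defining f(x) = ∫ a σ(wᵀx+b) dρ(a,w,b). Then for every m ∈ ℕ, m ≥ 1, there exist parameters (a_i, w_i, b_i) ∈ ℝ × ℝᵈ × ℝ, i = 1,…,m, such that the finite two-layer network f_m(x) = Σ_{i=1}^m a_i σ(w_iᵀx + b_i) satisfies (∫_{ℝᵈ} (f_m(x) − f(x))² dμ(x))^{1/2} ≤ √(3 C_σ) · B / √m. -/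
open MeasureTheory

theorem barron_greedy {X Y : Type*} [MeasurableSpace X] [MeasurableSpace Y]
    (μ : Measure X) [IsProbabilityMeasure μ] (ρ : Measure Y) [IsProbabilityMeasure ρ]
    (F : X → Y → ℝ) (hF : Measurable (Function.uncurry F))
    (G : Y → ℝ) (hG : Integrable G ρ) (hG2 : Integrable (fun q => G q ^ 2) ρ)
    (hFG : ∀ᵐ x ∂μ, ∀ q, |F x q| ≤ G q)
    (f : X → ℝ) (hf : ∀ x, f x = ∫ q, F x q ∂ρ) (m : ℕ) :
    ∃ q : Fin m → Y, ∫ x, ((∑ i, F x (q i)) - m * f x) ^ 2 ∂μ ≤ m * ∫ q, G q ^ 2 ∂ρ := by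
  have hfm : Measurable f := by
    have h : f = fun x => ∫ q, F x q ∂ρ := funext hf
    rw [h]
    exact (hF.stronglyMeasurable.integral_prod_right').measurable
  have hFx : ∀ x, Measurable (F x) := fun x => hF.comp measurable_prodMk_left
  have hFq : ∀ q, Measurable (fun x => F x q) := fun q => hF.comp measurable_prodMk_right
  have hfM : ∀ᵐ x ∂μ, |f x| ≤ ∫ q, G q ∂ρ := by
    filter_upwards [hFG] with x hx
    rw [hf]
    exact norm_integral_le_of_norm_le (f := F x) hG (Filter.Eventually.of_forall hx)
  set M := ∫ q, G q ∂ρ with hM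
  induction m with
  | zero => exact ⟨Fin.elim0, by simp⟩
  | succ m ih =>
    obtain ⟨p, hp⟩ := ih
    set S : X → ℝ := fun x => (∑ i, F x (p i)) - m * f x with hS
    have hSm : Measurable S := by
      refine Measurable.sub (Finset.measurable_sum _ fun i _ => hFq _) (hfm.const_mul _)
    set C : ℝ := (∑ i, G (p i)) + m * M with hC
    have hSC : ∀ᵐ x ∂μ, |S x| ≤ C := by
      filter_upwards [hFG, hfM] with x hx hx'
      calc |S x| ≤ |∑ i, F x (p i)| + |m * f x| := abs_sub _ _
        _ ≤ (∑ i, |F x (p i)|) + m * |f x| := by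
          rw [abs_mul, Nat.abs_cast]
          gcongr
          exact Finset.abs_sum_le_sum_abs _ _
        _ ≤ C := by
          rw [hC]
          gcongr with i _
          exact hx _
    have hS2 : Integrable (fun x => S x ^ 2) μ := by
      refine Integrable.of_bound (C := C ^ 2) (hSm.pow_const 2).aestronglyMeasurable ?_
      filter_upwards [hSC] with x hx
      rw [Real.norm_eq_abs, abs_pow]
      gcongr
    set H : X × Y → ℝ := fun z => (S z.1 + F z.1 z.2 - f z.1) ^ 2 with hH
    have hHm : Measurable H :=
      (((hSm.comp measurable_fst).add hF).sub (hfm.comp measurable_fst)).pow_const 2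
    have hHint : Integrable H (μ.prod ρ) := by
      have hdom : Integrable (fun z : X × Y => 2 * (C + M) ^ 2 + 2 * G z.2 ^ 2) (μ.prod ρ) :=
        (integrable_const _).add ((hG2.comp_snd μ).const_mul 2)
      refine hdom.mono' hHm.aestronglyMeasurable ?_
      have h1 := (Measure.quasiMeasurePreserving_fst (μ := μ) (ν := ρ)).ae
        (hFG.and (hfM.and hSC))
      filter_upwards [h1] with z hz
      obtain ⟨h1, h2, h3⟩ := hz
      have h1 := h1 z.2
      rw [Real.norm_eq_abs, abs_of_nonneg (sq_nonneg _)]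
      have : |S z.1 + F z.1 z.2 - f z.1| ≤ (C + M) + G z.2 := by
        rw [abs_le] at *
        constructor <;> linarith
      have h4 := pow_le_pow_left₀ (abs_nonneg _) this 2
      rw [sq_abs] at h4
      nlinarith [sq_nonneg (C + M - G z.2)]
    have key : ∀ᵐ x ∂μ, ∫ q, H (x, q) ∂ρ ≤ S x ^ 2 + ∫ q, G q ^ 2 ∂ρ := by
      filter_upwards [hFG] with x hx
      have i1 : Integrable (F x) ρ :=
        hG.mono' (hFx x).aestronglyMeasurable (Filter.Eventually.of_forall hx)
      have hsq : ∀ q, F x q ^ 2 ≤ G q ^ 2 := fun q => by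
        rw [← sq_abs (F x q)]
        exact pow_le_pow_left₀ (abs_nonneg _) (hx q) 2
      have i2 : Integrable (fun q => F x q ^ 2) ρ := by
        refine hG2.mono' ((hFx x).pow_const 2).aestronglyMeasurable
          (Filter.Eventually.of_forall fun q => ?_)
        rw [Real.norm_eq_abs, abs_of_nonneg (sq_nonneg _)]
        exact hsq q
      have e : ∀ q, H (x, q) = F x q ^ 2 + (2 * (S x - f x) * F x q + (S x - f x) ^ 2) := by
        intro q; simp only [hH]; ring
      simp_rw [e]
      have i3 : Integrable (fun q => 2 * (S x - f x) * F x q + (S x - f x) ^ 2) ρ :=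
        (i1.const_mul _).add (integrable_const _)
      rw [integral_add i2 i3,
        integral_add (i1.const_mul _) (integrable_const _), integral_const_mul, ← hf]
      have := integral_mono i2 hG2 hsq
      simp only [integral_const, probReal_univ, one_smul]
      nlinarith [sq_nonneg (f x)]
    obtain ⟨q, hq⟩ := exists_le_integral hHint.integral_prod_right
    have hfin : ∫ x, H (x, q) ∂μ ≤ (m + 1) * ∫ q, G q ^ 2 ∂ρ := by
      refine hq.trans ?_
      rw [← integral_integral_swap (f := fun x q => H (x, q)) hHint]
      calc ∫ x, ∫ q, H (x, q) ∂ρ ∂μ ≤ ∫ x, (S x ^ 2 + ∫ q, G q ^ 2 ∂ρ) ∂μ :=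
            integral_mono_ae hHint.integral_prod_left (hS2.add (integrable_const _)) key
        _ = (∫ x, S x ^ 2 ∂μ) + ∫ q, G q ^ 2 ∂ρ := by
            rw [integral_add hS2 (integrable_const _)]; simp
        _ ≤ _ := by linarith
    refine ⟨Fin.snoc p q, ?_⟩
    push_cast
    refine le_trans (le_of_eq ?_) hfin
    refine integral_congr_ae (Filter.Eventually.of_forall fun x => ?_)
    simp only [Fin.sum_univ_castSucc, Fin.snoc_castSucc, Fin.snoc_last, hH, hS]
    ring

theorem barron_growth (σ : ℝ → ℝ) (hσ : ContDiff ℝ 2 σ)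
    (hγ0fin : Integrable (fun x : ℝ => |deriv (deriv σ) x| * (|x| + 1)))
    (σp σn : ℝ)
    (hσp : Filter.Tendsto (deriv σ) Filter.atTop (nhds σp))
    (hσn : Filter.Tendsto (deriv σ) Filter.atBot (nhds σn)) (y : ℝ) :
    |σ y| ≤ |σ 0| +
      ((∫ x : ℝ, |deriv (deriv σ) x| * (|x| + 1)) + min |σp| |σn|) * |y| := by
  have hd1 : ContDiff ℝ 1 (deriv σ) := ((contDiff_succ_iff_deriv (n := 1)).1 hσ).2.2
  have hc : Continuous (deriv (deriv σ)) := hd1.continuous_deriv le_rfl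
  have hder : ∀ x, HasDerivAt (deriv σ) (deriv (deriv σ) x) x :=
    fun x => (hd1.differentiable one_ne_zero x).hasDerivAt
  have hle : ∀ x, ‖deriv (deriv σ) x‖ ≤ |deriv (deriv σ) x| * (|x| + 1) := fun x => by
    rw [Real.norm_eq_abs]
    nlinarith [mul_nonneg (abs_nonneg (deriv (deriv σ) x)) (abs_nonneg x)]
  have hint : Integrable (deriv (deriv σ)) :=
    hγ0fin.mono' hc.aestronglyMeasurable (Filter.Eventually.of_forall hle)
  have hset : ∀ s : Set ℝ, |∫ x in s, deriv (deriv σ) x| ≤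
      ∫ x : ℝ, |deriv (deriv σ) x| * (|x| + 1) := fun s => by
    refine (norm_integral_le_integral_norm (deriv (deriv σ))).trans ?_
    refine (setIntegral_le_integral hint.norm
      (Filter.Eventually.of_forall fun x => norm_nonneg _)).trans ?_
    exact integral_mono hint.norm hγ0fin hle
  have hb : ∀ z, |deriv σ z| ≤
      (∫ x : ℝ, |deriv (deriv σ) x| * (|x| + 1)) + min |σp| |σn| := fun z => by
    have h1 := integral_Ioi_of_hasDerivAt_of_tendsto' (a := z) (fun x _ => hder x)
      hint.integrableOn hσp
    have h2 := integral_Iic_of_hasDerivAt_of_tendsto' (a := z) (fun x _ => hder x)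
      hint.integrableOn hσn
    have h3 := hset (Set.Ioi z)
    have h4 := hset (Set.Iic z)
    rw [h1] at h3
    rw [h2] at h4
    have h5 := abs_sub_abs_le_abs_sub (deriv σ z) σp
    rw [abs_sub_comm] at h5
    have h6 := abs_sub_abs_le_abs_sub (deriv σ z) σn
    rcases min_choice |σp| |σn| with h | h <;> rw [h] <;> linarith
  have hmv := Convex.norm_image_sub_le_of_norm_deriv_le (f := σ) (s := Set.univ) (x := 0) (y := y)
    (fun x _ => hσ.differentiable two_ne_zero x) (fun x _ => hb x) convex_univ
    (Set.mem_univ _) (Set.mem_univ _)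
  rw [Real.norm_eq_abs, Real.norm_eq_abs, sub_zero] at hmv
  have := abs_sub_abs_le_abs_sub (σ y) (σ 0)
  linarith

/-- Theorem 1 (approximation rate for Barron functions): for a twice continuously
differentiable activation `σ` with `γ₀(σ) < ∞` and existing limits of `σ'` at `±∞`,
any infinite-width network `f` represented by a probability measure `ρ` with finite
Barron cost `B` can be approximated in `L²(μ)` (for `μ` supported in the sup-norm
unit ball) by an `m`-neuron two-layer network with error at most `√(3 C_σ) B / √m`. -/
theorem barron_two_layer_approximation
    (d : ℕ) (σ : ℝ → ℝ) (hσ : ContDiff ℝ 2 σ)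
    (hγ0fin : Integrable (fun x : ℝ => |deriv (deriv σ) x| * (|x| + 1)))
    (σp σn : ℝ)
    (hσp : Filter.Tendsto (deriv σ) Filter.atTop (nhds σp))
    (hσn : Filter.Tendsto (deriv σ) Filter.atBot (nhds σn))
    (Cσ : ℝ)
    (hCσ : Cσ = ((∫ x : ℝ, |deriv (deriv σ) x| * (|x| + 1)) +
        (⨅ x : ℝ, (|σ x| + (|x| + 2) * |deriv σ x|)) + min |σp| |σn| + |σ 0|) ^ 2)
    (μ : Measure (Fin d → ℝ)) [IsProbabilityMeasure μ]
    (hμ : ∀ᵐ x ∂μ, ‖x‖ ≤ 1)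
    (ρ : Measure (ℝ × (Fin d → ℝ) × ℝ)) [IsProbabilityMeasure ρ]
    (hρint : Integrable (fun q : ℝ × (Fin d → ℝ) × ℝ =>
        q.1 ^ 2 * ((∑ i, |q.2.1 i|) + |q.2.2| + 1) ^ 2) ρ)
    (B : ℝ) (hB0 : 0 ≤ B)
    (hB : B ^ 2 = ∫ q : ℝ × (Fin d → ℝ) × ℝ,
        q.1 ^ 2 * ((∑ i, |q.2.1 i|) + |q.2.2| + 1) ^ 2 ∂ρ)
    (f : (Fin d → ℝ) → ℝ)
    (hf : ∀ x, f x = ∫ q : ℝ × (Fin d → ℝ) × ℝ,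
        q.1 * σ ((∑ i, q.2.1 i * x i) + q.2.2) ∂ρ)
    (m : ℕ) (hm : 1 ≤ m) :
    ∃ (a : Fin m → ℝ) (w : Fin m → Fin d → ℝ) (b : Fin m → ℝ),
      Real.sqrt (∫ x, ((∑ i, a i * σ ((∑ j, w i j * x j) + b i)) - f x) ^ 2 ∂μ) ≤
        Real.sqrt (3 * Cσ) * B / Real.sqrt m := by
  set γ0 := ∫ x : ℝ, |deriv (deriv σ) x| * (|x| + 1) with hγ0
  set U := ⨅ x : ℝ, (|σ x| + (|x| + 2) * |deriv σ x|) with hU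
  have hγ0' : 0 ≤ γ0 := integral_nonneg fun x => by positivity
  have hU' : 0 ≤ U := Real.iInf_nonneg fun x => by positivity
  have hmin : 0 ≤ min |σp| |σn| := le_min (abs_nonneg _) (abs_nonneg _)
  set K := γ0 + U + min |σp| |σn| + |σ 0| with hK
  have hK0 : 0 ≤ K := by positivity
  have hgr : ∀ y, |σ y| ≤ K * (|y| + 1) := fun y => by
    have := barron_growth σ hσ hγ0fin σp σn hσp hσn y
    rw [← hγ0] at this
    have h0 := abs_nonneg (σ 0)
    have h1 := abs_nonneg y
    rw [hK]
    nlinarith [mul_nonneg hU' h1, mul_nonneg h0 h1]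
  set F : (Fin d → ℝ) → (ℝ × (Fin d → ℝ) × ℝ) → ℝ :=
    fun x q => q.1 * σ ((∑ i, q.2.1 i * x i) + q.2.2) with hF
  have hσc : Continuous σ := hσ.continuous
  have hFm : Measurable (Function.uncurry F) := by
    apply Continuous.measurable
    simp only [hF, Function.uncurry_def]
    fun_prop
  set G0 : (ℝ × (Fin d → ℝ) × ℝ) → ℝ :=
    fun q => |q.1| * ((∑ i, |q.2.1 i|) + |q.2.2| + 1) with hG0
  have hG0m : Measurable G0 := by
    apply Continuous.measurable
    simp only [hG0]
    fun_prop
  have hG0sq : ∀ q, G0 q ^ 2 = q.1 ^ 2 * ((∑ i, |q.2.1 i|) + |q.2.2| + 1) ^ 2 := fun q => by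
    simp only [hG0, mul_pow, sq_abs]
  simp_rw [← hG0sq] at hρint hB
  have hG0i : Integrable G0 ρ := by
    have : MemLp G0 2 ρ := (memLp_two_iff_integrable_sq hG0m.aestronglyMeasurable).2 hρint
    exact this.integrable (by norm_num)
  have hFG : ∀ᵐ x ∂μ, ∀ q, |F x q| ≤ K * G0 q := by
    filter_upwards [hμ] with x hx q
    have hy : |(∑ i, q.2.1 i * x i) + q.2.2| ≤ (∑ i, |q.2.1 i|) + |q.2.2| := by
      refine (abs_add_le _ _).trans ?_
      gcongr
      refine (Finset.abs_sum_le_sum_abs _ _).trans (Finset.sum_le_sum fun i _ => ?_)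
      rw [abs_mul]
      have := (norm_le_pi_norm x i).trans hx
      rw [Real.norm_eq_abs] at this
      exact mul_le_of_le_one_right (abs_nonneg _) this
    have h1 : |σ ((∑ i, q.2.1 i * x i) + q.2.2)| ≤ K * ((∑ i, |q.2.1 i|) + |q.2.2| + 1) :=
      (hgr _).trans (by gcongr)
    simp only [hF, hG0, abs_mul]
    calc _ ≤ |q.1| * (K * ((∑ i, |q.2.1 i|) + |q.2.2| + 1)) := by gcongr
      _ = _ := by ring
  obtain ⟨p, hp⟩ := barron_greedy μ ρ F hFm (fun q => K * G0 q) (hG0i.const_mul K)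
    (by simp_rw [mul_pow]; exact hρint.const_mul _) hFG f hf m
  simp_rw [mul_pow] at hp
  rw [integral_const_mul, ← hB] at hp
  have hm0 : (0 : ℝ) < m := by exact_mod_cast hm
  refine ⟨fun i => (p i).1 / m, fun i => (p i).2.1, fun i => (p i).2.2, ?_⟩
  have e : ∀ x, ((∑ i, (p i).1 / m * σ ((∑ j, (p i).2.1 j * x j) + (p i).2.2)) - f x) ^ 2
      = (1 / (m : ℝ) ^ 2) * ((∑ i, F x (p i)) - m * f x) ^ 2 := fun x => by
    have : ∑ i, (p i).1 / m * σ ((∑ j, (p i).2.1 j * x j) + (p i).2.2)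
        = (∑ i, F x (p i)) / m := by
      rw [Finset.sum_div]
      refine Finset.sum_congr rfl fun i _ => ?_
      simp only [hF]; ring
    rw [this]
    field_simp
  simp_rw [e]
  rw [integral_const_mul]
  apply Real.sqrt_le_iff.2
  refine ⟨by positivity, ?_⟩
  rw [div_pow, mul_pow, Real.sq_sqrt hm0.le, Real.sq_sqrt (by rw [hCσ]; positivity), hCσ]
  calc _ ≤ 1 / (m : ℝ) ^ 2 * (m * (K ^ 2 * B ^ 2)) := by gcongr
    _ = K ^ 2 * B ^ 2 / m := by field_simp
    _ ≤ _ := by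
      gcongr
      nlinarith [sq_nonneg K]
end

section
/- (Infinite-width two-layer networks with finite Barron cost are well defined and Lipschitz on the unit ball.) Let σ : ℝ → ℝ be Lipschitz continuous with Lipschitz constant L_σ, and let ρ be a probability measure on ℝ × ℝᵈ × ℝ with ∫ |a|(‖w‖₁ + |b| + 1) dρ(a,w,b) < ∞. Then for every x ∈ ℝᵈ with ‖x‖_∞ ≤ 1 the function (a,w,b) ↦ a σ(wᵀx + b) is ρ-integrable, so f_ρ(x) = ∫ a σ(wᵀx + b) dρ(a,w,b) is well defined, and for all x, y with ‖x‖_∞ ≤ 1 and ‖y‖_∞ ≤ 1 one has |f_ρ(x) − f_ρ(y)| ≤ L_σ (∫ |a| ‖w‖₁ dρ(a,w,b)) ‖x − y‖_∞; in particular f_ρ is continuous on the sup-norm unit ball. -/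
open MeasureTheory

/-- Infinite-width two-layer networks with finite Barron cost are well defined and
Lipschitz (hence continuous) on the sup-norm unit ball: if `σ` is `L_σ`-Lipschitz and
`∫ |a|(‖w‖₁ + |b| + 1) dρ < ∞`, then `f_ρ(x) = ∫ a σ(wᵀx + b) dρ` is defined for every
`x` in the unit ball and `|f_ρ(x) − f_ρ(y)| ≤ L_σ (∫ |a| ‖w‖₁ dρ) ‖x − y‖_∞` there. -/
theorem barron_representation_wellDefined_lipschitz
    (d : ℕ) (σ : ℝ → ℝ) (Lσ : ℝ) (hLσ : 0 ≤ Lσ)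
    (hσ : ∀ x y : ℝ, |σ x - σ y| ≤ Lσ * |x - y|)
    (ρ : Measure (ℝ × (Fin d → ℝ) × ℝ)) [IsProbabilityMeasure ρ]
    (hρint : Integrable (fun q : ℝ × (Fin d → ℝ) × ℝ =>
        |q.1| * ((∑ i, |q.2.1 i|) + |q.2.2| + 1)) ρ)
    (fρ : (Fin d → ℝ) → ℝ)
    (hfρ : ∀ x, fρ x = ∫ q : ℝ × (Fin d → ℝ) × ℝ,
        q.1 * σ ((∑ i, q.2.1 i * x i) + q.2.2) ∂ρ) :
    (∀ x : Fin d → ℝ, ‖x‖ ≤ 1 →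
        Integrable (fun q : ℝ × (Fin d → ℝ) × ℝ =>
          q.1 * σ ((∑ i, q.2.1 i * x i) + q.2.2)) ρ) ∧
    (∀ x y : Fin d → ℝ, ‖x‖ ≤ 1 → ‖y‖ ≤ 1 →
        |fρ x - fρ y| ≤
          Lσ * (∫ q : ℝ × (Fin d → ℝ) × ℝ, |q.1| * (∑ i, |q.2.1 i|) ∂ρ) * ‖x - y‖) ∧
    ContinuousOn fρ {x : Fin d → ℝ | ‖x‖ ≤ 1} := by
  have hσc : Continuous σ := by
    have h : LipschitzWith (Real.toNNReal Lσ) σ := by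
      apply LipschitzWith.of_dist_le_mul
      intro x y
      rw [Real.dist_eq, Real.dist_eq, Real.coe_toNNReal _ hLσ]
      exact hσ x y
    exact h.continuous
  have hdot : ∀ w x : Fin d → ℝ, |∑ i, w i * x i| ≤ (∑ i, |w i|) * ‖x‖ := by
    intro w x
    rw [Finset.sum_mul]
    refine (Finset.abs_sum_le_sum_abs _ _).trans (Finset.sum_le_sum fun i _ => ?_)
    rw [abs_mul]
    exact mul_le_mul_of_nonneg_left (norm_le_pi_norm x i) (abs_nonneg _)
  have hS : ∀ w : Fin d → ℝ, 0 ≤ ∑ i, |w i| := fun w =>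
    Finset.sum_nonneg fun i _ => abs_nonneg _
  have hint : ∀ x : Fin d → ℝ, ‖x‖ ≤ 1 →
        Integrable (fun q : ℝ × (Fin d → ℝ) × ℝ =>
          q.1 * σ ((∑ i, q.2.1 i * x i) + q.2.2)) ρ := by
    intro x hx
    refine (hρint.const_mul (Lσ + |σ 0|)).mono'
      (Continuous.aestronglyMeasurable (by fun_prop)) (Filter.Eventually.of_forall ?_)
    rintro ⟨a, w, b⟩
    simp only [Real.norm_eq_abs, abs_mul]
    have h1 := hdot w x
    have h2 : (∑ i, |w i|) * ‖x‖ ≤ ∑ i, |w i| := mul_le_of_le_one_right (hS w) hx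
    have h3 := abs_add_le (∑ i, w i * x i) b
    have h4 := hσ ((∑ i, w i * x i) + b) 0
    rw [sub_zero] at h4
    have h5 := abs_sub_abs_le_abs_sub (σ ((∑ i, w i * x i) + b)) (σ 0)
    have h6 : Lσ * |(∑ i, w i * x i) + b| ≤ Lσ * ((∑ i, |w i|) + |b|) :=
      mul_le_mul_of_nonneg_left (by linarith) hLσ
    have h7 : |σ ((∑ i, w i * x i) + b)| ≤ (Lσ + |σ 0|) * ((∑ i, |w i|) + |b| + 1) := by
      have := mul_nonneg (abs_nonneg (σ 0)) (add_nonneg (hS w) (abs_nonneg b))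
      nlinarith
    calc _ ≤ |a| * ((Lσ + |σ 0|) * ((∑ i, |w i|) + |b| + 1)) :=
          mul_le_mul_of_nonneg_left h7 (abs_nonneg a)
      _ = _ := by ring
  have hintS : Integrable (fun q : ℝ × (Fin d → ℝ) × ℝ => |q.1| * (∑ i, |q.2.1 i|)) ρ := by
    refine hρint.mono'
      (Continuous.aestronglyMeasurable (by fun_prop)) (Filter.Eventually.of_forall ?_)
    rintro ⟨a, w, b⟩
    simp only [Real.norm_eq_abs]
    rw [abs_of_nonneg (mul_nonneg (abs_nonneg a) (hS w))]
    exact mul_le_mul_of_nonneg_left (by linarith [abs_nonneg b]) (abs_nonneg a)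
  have hlip : ∀ x y : Fin d → ℝ, ‖x‖ ≤ 1 → ‖y‖ ≤ 1 →
        |fρ x - fρ y| ≤
          Lσ * (∫ q : ℝ × (Fin d → ℝ) × ℝ, |q.1| * (∑ i, |q.2.1 i|) ∂ρ) * ‖x - y‖ := by
    intro x y hx hy
    rw [hfρ, hfρ, ← integral_sub (hint x hx) (hint y hy), mul_right_comm,
      ← integral_const_mul, ← Real.norm_eq_abs]
    refine norm_integral_le_of_norm_le (hintS.const_mul _) (Filter.Eventually.of_forall ?_)
    rintro ⟨a, w, b⟩
    simp only [Real.norm_eq_abs]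
    rw [← mul_sub, abs_mul]
    have h1 := hσ ((∑ i, w i * x i) + b) ((∑ i, w i * y i) + b)
    have h2 := hdot w (x - y)
    have h3 : ((∑ i, w i * x i) + b) - ((∑ i, w i * y i) + b) = ∑ i, w i * (x - y) i := by
      simp [mul_sub, Finset.sum_sub_distrib]
    rw [h3] at h1
    have h4 := h1.trans (mul_le_mul_of_nonneg_left h2 hLσ)
    calc _ ≤ |a| * (Lσ * ((∑ i, |w i|) * ‖x - y‖)) :=
          mul_le_mul_of_nonneg_left h4 (abs_nonneg a)
      _ = _ := by ring
  refine ⟨hint, hlip, ?_⟩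
  have hC : 0 ≤ Lσ * (∫ q : ℝ × (Fin d → ℝ) × ℝ, |q.1| * (∑ i, |q.2.1 i|) ∂ρ) :=
    mul_nonneg hLσ (integral_nonneg fun q => mul_nonneg (abs_nonneg _) (hS _))
  have hL : LipschitzOnWith (Real.toNNReal
      (Lσ * (∫ q : ℝ × (Fin d → ℝ) × ℝ, |q.1| * (∑ i, |q.2.1 i|) ∂ρ))) fρ
      {x : Fin d → ℝ | ‖x‖ ≤ 1} := by
    apply LipschitzOnWith.of_dist_le_mul
    intro x hx y hy
    rw [Real.dist_eq, dist_eq_norm, Real.coe_toNNReal _ hC]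
    exact hlip x y hx hy
  exact hL.continuousOn
end
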